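/- Let p ≥ 1 be an integer, L_p > 0, T ≥ 1 an integer, and let f̄ : ℝ^{T+1} × ℝ^{T+1} → ℝ be the hard instance f̄(x,y) = (L_p/(2^{p+1} p!)) ( y_1 (1 − x_1)^p + Σ_{i=1}^{T} y_{i+1} (x_i − x_{i+1})^p ). Then f̄ is p-times continuously differentiable and its pth derivative is L_p-Lipschitz: for all z, z' ∈ ℝ^{T+1} × ℝ^{T+1}, ‖∇^p f̄(z) − ∇^p f̄(z')‖ ≤ L_p ‖z − z'‖, where ∇^p f̄(z) is the pth iterated (Fréchet) derivative at z and ‖T‖ denotes its operator norm, i.e. the supremum of |T[v_1, …, v_p]| over vectors with ‖v_i‖ ≤ 1. -/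

import Mathlib

noncomputable section

/-- The Euclidean space `ℝ^(T+1)`. -/
abbrev Euc (T : ℕ) := EuclideanSpace ℝ (Fin (T + 1))

/-- `ℝ^(T+1) × ℝ^(T+1)` equipped with the Euclidean (`L²`) norm. -/
abbrev EucProd (T : ℕ) := WithLp 2 (Euc T × Euc T)

section IteratedDerivatives

variable {E : Type*} [NormedAddCommGroup E] [NormedSpace ℝ E]

/-- The top derivative of the `n`th power of an affine function. -/
lemma iteratedFDeriv_affine_pow (l : E →L[ℝ] ℝ) (c : ℝ) (n : ℕ) (z : E) (m : Fin n → E) :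
    iteratedFDeriv ℝ n (fun x => (l x + c) ^ n) z m = (n.factorial : ℝ) * ∏ i, l (m i) := by
  induction n with
  | zero => simp
  | succ n ih =>
    have hfd : (fun x => fderiv ℝ (fun x => (l x + c) ^ (n + 1)) x (m (Fin.last n))) =
        fun x => (((n : ℝ) + 1) * l (m (Fin.last n))) • (l x + c) ^ n := by
      funext x
      have h : HasFDerivAt (fun x => (l x + c) ^ (n + 1)) _ x :=
        (l.hasFDerivAt.add_const c).pow (n + 1)
      rw [h.fderiv]
      simp
      ring
    have hc : ContDiff ℝ n (fun x => fderiv ℝ (fun x => (l x + c) ^ (n + 1)) x) :=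
      ContDiff.fderiv_right (m := n) (n := (n + 1 : ℕ)) (by fun_prop) (by norm_cast)
    rw [iteratedFDeriv_succ_apply_right, ← iteratedFDeriv_clm_apply_const_apply hc le_rfl, hfd,
      iteratedFDeriv_const_smul_apply' (by fun_prop), smul_apply, ih,
      Fin.prod_univ_castSucc, Nat.factorial_succ]
    simp only [Fin.init, smul_eq_mul]
    push_cast
    ring

/-- Splitting off the last index in a symmetrized product. -/
lemma Fin.sum_mul_prod_succAbove_castSucc {n : ℕ} (a b : Fin (n + 2) → ℝ) :
    ∑ j, a j * ∏ i, b (j.succAbove i) =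
      a (Fin.last (n + 1)) * ∏ i : Fin (n + 1), b i.castSucc +
        b (Fin.last (n + 1)) *
          ∑ j : Fin (n + 1), a j.castSucc * ∏ i, b (j.succAbove i).castSucc := by
  rw [Fin.sum_univ_castSucc, add_comm, Finset.mul_sum]
  congr 1
  · simp
  · refine Finset.sum_congr rfl fun j _ => ?_
    rw [Fin.prod_univ_castSucc]
    simp only [Fin.castSucc_succAbove_castSucc, Fin.succAbove_ne_last_last (Fin.castSucc_ne_last j)]
    ring

/-- The top derivative of the product of a linear form with the `n`th power of an affine
function. -/
lemma iteratedFDeriv_linear_mul_affine_pow (h l : E →L[ℝ] ℝ) (c : ℝ) (n : ℕ) (z : E)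
    (m : Fin (n + 1) → E) :
    iteratedFDeriv ℝ (n + 1) (fun x => h x * (l x + c) ^ n) z m =
      (n.factorial : ℝ) * ∑ j, h (m j) * ∏ i, l (m (j.succAbove i)) := by
  induction n with
  | zero =>
    have hfd : (fun x => fderiv ℝ (fun x => h x * (l x + c) ^ 0) x) = fun _ => h := by
      funext x
      simp
    rw [iteratedFDeriv_succ_apply_right, hfd]
    simp
  | succ n ih =>
    have hfd : (fun x => fderiv ℝ (fun x => h x * (l x + c) ^ (n + 1)) x
          (m (Fin.last (n + 1)))) =
        fun x => h (m (Fin.last (n + 1))) • (l x + c) ^ (n + 1) +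
          (((n : ℝ) + 1) * l (m (Fin.last (n + 1)))) • (h x * (l x + c) ^ n) := by
      funext x
      have h : HasFDerivAt (fun x => h x * (l x + c) ^ (n + 1)) _ x :=
        h.hasFDerivAt.mul ((l.hasFDerivAt.add_const c).pow (n + 1))
      rw [h.fderiv]
      simp
      ring
    have hc : ContDiff ℝ (n + 1 : ℕ)
        (fun x => fderiv ℝ (fun x => h x * (l x + c) ^ (n + 1)) x) :=
      ContDiff.fderiv_right (m := (n + 1 : ℕ)) (n := (n + 1 + 1 : ℕ)) (by fun_prop)
        (by norm_cast)
    rw [iteratedFDeriv_succ_apply_right, ← iteratedFDeriv_clm_apply_const_apply hc le_rfl, hfd,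
      fun_iteratedFDeriv_add_apply (by fun_prop) (by fun_prop),
      iteratedFDeriv_const_smul_apply' (by fun_prop),
      iteratedFDeriv_const_smul_apply' (by fun_prop), add_apply,
      smul_apply, smul_apply, ih,
      iteratedFDeriv_affine_pow,
      Fin.sum_mul_prod_succAbove_castSucc (fun j => h (m j)) (fun j => l (m j)),
      Nat.factorial_succ]
    simp only [Fin.init, smul_eq_mul]
    push_cast
    ring

end IteratedDerivatives

section Bounds

lemma sq_sum_mul_prod_succAbove_le {n : ℕ} (a b N : Fin (n + 1) → ℝ)
    (h : ∀ j, a j ^ 2 + b j ^ 2 ≤ N j ^ 2) :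
    (∑ j, a j * ∏ i, b (j.succAbove i)) ^ 2 ≤ ((n : ℝ) + 1) * ∏ j, N j ^ 2 := by
  induction n with
  | zero => simpa using (le_add_of_nonneg_right (sq_nonneg (b 0))).trans (h 0)
  | succ n ih =>
    have hS := ih (fun j => a j.castSucc) (fun j => b j.castSucc) (fun j => N j.castSucc)
      fun j => h j.castSucc
    have hP : (∏ i : Fin (n + 1), b i.castSucc) ^ 2 ≤ ∏ i : Fin (n + 1), N i.castSucc ^ 2 := by
      rw [← Finset.prod_pow]
      exact Finset.prod_le_prod (fun _ _ => sq_nonneg _)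
        fun j _ => (le_add_of_nonneg_left (sq_nonneg _)).trans (h j.castSucc)
    rw [Fin.sum_mul_prod_succAbove_castSucc, Fin.prod_univ_castSucc fun j => N j ^ 2]
    set S := ∑ j : Fin (n + 1), a j.castSucc * ∏ i, b (j.succAbove i).castSucc
    set P := ∏ i : Fin (n + 1), b i.castSucc
    set Q := ∏ i : Fin (n + 1), N i.castSucc ^ 2
    set u := a (Fin.last (n + 1))
    set v := b (Fin.last (n + 1))
    calc (u * P + v * S) ^ 2 ≤ (u ^ 2 + v ^ 2) * (P ^ 2 + S ^ 2) := by
          nlinarith [sq_nonneg (u * S - v * P)]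
      _ ≤ N (Fin.last (n + 1)) ^ 2 * (Q + ((n : ℝ) + 1) * Q) := by
          gcongr
          exact h _
      _ = _ := by
          push_cast
          ring

variable {ι : Type*} [Fintype ι]

lemma sum_abs_mul_prod_le {n : ℕ} (u : ι → ℝ) (w : Fin (n + 1) → ι → ℝ) (A : ℝ)
    (B : Fin (n + 1) → ℝ) (hA : 0 ≤ A) (hB : ∀ i, 0 ≤ B i)
    (hu : ∑ k, u k ^ 2 ≤ A ^ 2) (hw : ∀ i, ∑ k, w i k ^ 2 ≤ 4 * B i ^ 2)
    (hw' : ∀ i k, w i k ^ 2 ≤ 2 * B i ^ 2) :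
    ∑ k, |u k * ∏ i, w i k| ≤ √2 ^ (n + 2) * (A * ∏ i, B i) := by
  have h2 : √2 ^ 2 = (2 : ℝ) := Real.sq_sqrt (by norm_num)
  have hsup : ∀ i k, |w i k| ≤ √2 * B i := fun i k => by
    apply abs_le_of_sq_le_sq _ (mul_nonneg (Real.sqrt_nonneg _) (hB i))
    rw [mul_pow, h2]
    exact hw' i k
  have hcs : ∑ k, |u k| * |w 0 k| ≤ A * (2 * B 0) := by
    apply le_of_sq_le_sq _ (mul_nonneg hA (mul_nonneg (by norm_num) (hB 0)))
    calc (∑ k, |u k| * |w 0 k|) ^ 2 ≤ (∑ k, |u k| ^ 2) * ∑ k, |w 0 k| ^ 2 :=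
          Finset.sum_mul_sq_le_sq_mul_sq _ _ _
      _ ≤ A ^ 2 * (4 * B 0 ^ 2) := by
          simp only [sq_abs]
          exact mul_le_mul hu (hw 0) (Finset.sum_nonneg fun _ _ => sq_nonneg _) (sq_nonneg A)
      _ = _ := by ring
  have hR : 0 ≤ ∏ i : Fin n, (√2 * B i.succ) :=
    Finset.prod_nonneg fun i _ => mul_nonneg (Real.sqrt_nonneg _) (hB _)
  calc ∑ k, |u k * ∏ i, w i k|
      ≤ ∑ k, |u k| * |w 0 k| * ∏ i : Fin n, (√2 * B i.succ) := by
        refine Finset.sum_le_sum fun k _ => ?_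
        rw [abs_mul, Finset.abs_prod, Fin.prod_univ_succ, ← mul_assoc]
        gcongr with i
        exact hsup _ _
    _ = (∑ k, |u k| * |w 0 k|) * ∏ i : Fin n, (√2 * B i.succ) := by rw [Finset.sum_mul]
    _ ≤ A * (2 * B 0) * ∏ i : Fin n, (√2 * B i.succ) := by gcongr
    _ = _ := by
        rw [Finset.prod_mul_distrib, Fin.prod_univ_succ B, pow_add, h2]
        simp
        ring

lemma sqrt_succ_le_sqrt_two_pow (n : ℕ) : √((n : ℝ) + 1) ≤ √2 ^ (n + 1) := by
  apply Real.sqrt_le_iff.2 ⟨by positivity, ?_⟩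
  rw [← pow_mul, mul_comm, pow_mul, Real.sq_sqrt (by norm_num)]
  exact_mod_cast (Nat.lt_two_pow_self (n := n + 1)).le

/-- A bound for sums over `k` of products `u · k * w · k * ⋯ * w · k`, symmetrized in the slots. -/
lemma abs_sum_sum_mul_prod_le {n : ℕ} (u w : Fin (n + 2) → ι → ℝ) (A B N : Fin (n + 2) → ℝ)
    (hA : ∀ j, 0 ≤ A j) (hB : ∀ j, 0 ≤ B j) (hN : ∀ j, 0 ≤ N j)
    (hAB : ∀ j, A j ^ 2 + B j ^ 2 ≤ N j ^ 2)
    (hu : ∀ j, ∑ k, u j k ^ 2 ≤ A j ^ 2) (hw : ∀ j, ∑ k, w j k ^ 2 ≤ 4 * B j ^ 2)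
    (hw' : ∀ j k, w j k ^ 2 ≤ 2 * B j ^ 2) :
    |∑ k, ∑ j, u j k * ∏ i, w (j.succAbove i) k| ≤ 2 ^ (n + 2) * ∏ j, N j := by
  have hNp : 0 ≤ ∏ j, N j := Finset.prod_nonneg fun j _ => hN j
  have hAB' : ∑ j, A j * ∏ i, B (j.succAbove i) ≤ √2 ^ (n + 2) * ∏ j, N j := by
    refine le_trans ?_
      (mul_le_mul_of_nonneg_right (sqrt_succ_le_sqrt_two_pow (n + 1)) hNp)
    apply le_of_sq_le_sq _ (by positivity)
    rw [mul_pow, Real.sq_sqrt (by positivity), ← Finset.prod_pow]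
    exact sq_sum_mul_prod_succAbove_le A B N hAB
  calc |∑ k, ∑ j, u j k * ∏ i, w (j.succAbove i) k|
      ≤ ∑ k, ∑ j, |u j k * ∏ i, w (j.succAbove i) k| :=
        (Finset.abs_sum_le_sum_abs _ _).trans
          (Finset.sum_le_sum fun k _ => Finset.abs_sum_le_sum_abs _ _)
    _ = ∑ j, ∑ k, |u j k * ∏ i, w (j.succAbove i) k| := Finset.sum_comm
    _ ≤ ∑ j, √2 ^ (n + 2) * (A j * ∏ i, B (j.succAbove i)) :=
        Finset.sum_le_sum fun j _ => sum_abs_mul_prod_le (u j) (fun i => w (j.succAbove i))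
          (A j) (fun i => B (j.succAbove i)) (hA j) (fun _ => hB _) (hu j) (fun _ => hw _)
          fun _ => hw' _
    _ = √2 ^ (n + 2) * ∑ j, A j * ∏ i, B (j.succAbove i) := by rw [Finset.mul_sum]
    _ ≤ √2 ^ (n + 2) * (√2 ^ (n + 2) * ∏ j, N j) := by gcongr
    _ = _ := by rw [← mul_assoc, ← mul_pow, Real.mul_self_sqrt (by norm_num)]

end Bounds

/-- The linear form `z ↦ y_k` on pairs `z = (x, y)`. -/
def yForm (T : ℕ) (k : Fin (T + 1)) : EucProd T →L[ℝ] ℝ :=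
  (EuclideanSpace.proj k).comp (WithLp.sndL 2 ℝ (Euc T) (Euc T))

/-- The linear form `z ↦ x_k` on pairs `z = (x, y)`. -/
def xForm (T : ℕ) (k : Fin (T + 1)) : EucProd T →L[ℝ] ℝ :=
  (EuclideanSpace.proj k).comp (WithLp.fstL 2 ℝ (Euc T) (Euc T))

/-- The backward differences `z ↦ x_{k-1} - x_k`, with `x_{-1} = 0`. -/
def diffForm (T : ℕ) : Fin (T + 1) → EucProd T →L[ℝ] ℝ :=
  Fin.cases (-xForm T 0) fun i => xForm T i.castSucc - xForm T i.succ

lemma sum_yForm_sq (T : ℕ) (v : EucProd T) : ∑ k, yForm T k v ^ 2 = ‖v.snd‖ ^ 2 := by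
  rw [EuclideanSpace.real_norm_sq_eq]
  rfl

lemma sum_xForm_sq (T : ℕ) (v : EucProd T) : ∑ k, xForm T k v ^ 2 = ‖v.fst‖ ^ 2 := by
  rw [EuclideanSpace.real_norm_sq_eq]
  rfl

lemma diffForm_sq_le (T : ℕ) (v : EucProd T) (k : Fin (T + 1)) :
    diffForm T k v ^ 2 ≤ 2 * ‖v.fst‖ ^ 2 := by
  rw [← sum_xForm_sq]
  induction k using Fin.cases with
  | zero =>
    have h := Finset.single_le_sum (f := fun k => xForm T k v ^ 2)
      (fun _ _ => sq_nonneg _) (Finset.mem_univ 0)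
    have h0 := sq_nonneg (xForm T 0 v)
    simp only [diffForm, Fin.cases_zero, neg_apply, neg_sq]
    linarith
  | succ i =>
    have h := Finset.add_le_sum (f := fun k => xForm T k v ^ 2)
      (fun _ _ => sq_nonneg _) (Finset.mem_univ i.castSucc) (Finset.mem_univ i.succ)
      (Fin.castSucc_lt_succ (i := i)).ne
    simp only [diffForm, Fin.cases_succ, sub_apply]
    nlinarith [sq_nonneg (xForm T i.castSucc v + xForm T i.succ v)]

lemma sum_diffForm_sq_le (T : ℕ) (v : EucProd T) :
    ∑ k, diffForm T k v ^ 2 ≤ 4 * ‖v.fst‖ ^ 2 := by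
  rw [← sum_xForm_sq, Fin.sum_univ_succ]
  simp only [diffForm, Fin.cases_zero, Fin.cases_succ, neg_apply, neg_sq,
    sub_apply]
  have h1 := Fin.sum_univ_succ fun k => xForm T k v ^ 2
  have h2 := Fin.sum_univ_castSucc fun k => xForm T k v ^ 2
  have h3 : ∑ i : Fin T, (xForm T i.castSucc v - xForm T i.succ v) ^ 2 ≤
      2 * ∑ i : Fin T, xForm T i.castSucc v ^ 2 + 2 * ∑ i : Fin T, xForm T i.succ v ^ 2 := by
    rw [Finset.mul_sum, Finset.mul_sum, ← Finset.sum_add_distrib]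
    exact Finset.sum_le_sum fun i _ => by
      nlinarith [sq_nonneg (xForm T i.castSucc v + xForm T i.succ v)]
  linarith [sq_nonneg (xForm T 0 v), sq_nonneg (xForm T (Fin.last T) v)]

/-- the hard instance `f̄`, viewed as a function of
`z = (x, y) ∈ ℝ^(T+1) × ℝ^(T+1)` (with the Euclidean norm on the product),
is `p`-times continuously differentiable and its `p`th iterated Fréchet
derivative is `L_p`-Lipschitz in the multilinear operator norm. -/
theorem stmt9 (p T : ℕ) (hp : 1 ≤ p) (hT : 1 ≤ T) (Lp : ℝ) (hLp : 0 < Lp)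
    (fbar : EucProd T → ℝ)
    (hfbar : fbar = fun z => Lp / (2 ^ (p + 1) * (p.factorial : ℝ)) *
      ((WithLp.equiv 2 (Euc T × Euc T) z).2 0 *
          (1 - (WithLp.equiv 2 (Euc T × Euc T) z).1 0) ^ p +
        ∑ i : Fin T, (WithLp.equiv 2 (Euc T × Euc T) z).2 i.succ *
          ((WithLp.equiv 2 (Euc T × Euc T) z).1 i.castSucc -
            (WithLp.equiv 2 (Euc T × Euc T) z).1 i.succ) ^ p)) :
    ContDiff ℝ p fbar ∧
      ∀ z z' : EucProd T,
        ‖iteratedFDeriv ℝ p fbar z - iteratedFDeriv ℝ p fbar z'‖ ≤ Lp * ‖z - z'‖ := by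
  have hform : fbar = fun z => (Lp / (2 ^ (p + 1) * (p.factorial : ℝ))) • ∑ k : Fin (T + 1),
      yForm T k z * (diffForm T k z + Fin.cases (motive := fun _ => ℝ) 1 (fun _ => 0) k) ^ p := by
    rw [hfbar]
    funext z
    rw [Fin.sum_univ_succ, smul_eq_mul]
    simp only [diffForm, Fin.cases_zero, Fin.cases_succ, add_zero, neg_apply,
      sub_apply, neg_add_eq_sub]
    rfl
  have hsmooth : ∀ n : ℕ, ContDiff ℝ n fbar := fun n => by
    rw [hform]
    fun_prop
  refine ⟨hsmooth p, fun z z' => ?_⟩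
  refine convex_univ.norm_image_sub_le_of_norm_fderiv_le (𝕜 := ℝ)
    (fun x _ => ((hsmooth (p + 1)).differentiable_iteratedFDeriv
      (by exact_mod_cast p.lt_succ_self)) x) (fun x _ => ?_) (Set.mem_univ z') (Set.mem_univ z)
  rw [norm_fderiv_iteratedFDeriv]
  refine ContinuousMultilinearMap.opNorm_le_bound hLp.le fun m => ?_
  rw [hform, iteratedFDeriv_const_smul_apply' (by fun_prop),
    iteratedFDeriv_fun_sum_apply (fun _ _ => by fun_prop), smul_apply,
    sum_apply]
  simp only [iteratedFDeriv_linear_mul_affine_pow]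
  rw [← Finset.mul_sum, smul_eq_mul, Real.norm_eq_abs, ← mul_assoc, abs_mul]
  have hconst : |Lp / (2 ^ (p + 1) * (p.factorial : ℝ)) * (p.factorial : ℝ)| =
      Lp / 2 ^ (p + 1) := by
    have : (p.factorial : ℝ) ≠ 0 := by positivity
    rw [abs_of_nonneg (by positivity)]
    field_simp
  obtain ⟨q, rfl⟩ : ∃ q, p = q + 1 := ⟨p - 1, by omega⟩
  have hbound := abs_sum_sum_mul_prod_le (fun j k => yForm T k (m j))
    (fun j k => diffForm T k (m j)) (fun j => ‖(m j).snd‖) (fun j => ‖(m j).fst‖)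
    (fun j => ‖m j‖) (fun _ => norm_nonneg _) (fun _ => norm_nonneg _) (fun _ => norm_nonneg _)
    (fun j => by rw [WithLp.prod_norm_sq_eq_of_L2, add_comm])
    (fun j => (sum_yForm_sq T (m j)).le) (fun j => sum_diffForm_sq_le T (m j))
    (fun j => diffForm_sq_le T (m j))
  rw [hconst]
  calc _ ≤ Lp / 2 ^ (q + 1 + 1) * (2 ^ (q + 2) * ∏ j, ‖m j‖) := by gcongr
    _ = _ := by
      field_simp
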